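/- Let d, m ≥ 1, let f_1,…,f_m : ℝ^d → ℝ be convex differentiable functions, w_1,…,w_m > 0, λ > 0, and set λ_j = λ/√w_j. Let S ⊆ {1,…,m} be nonempty, θ* ∈ ℝ^d, M > 0 and 0 < ρ ≤ L < ∞ be such that for each j ∈ S, f_j is twice continuously differentiable with ρ·I ⪯ ∇²f_j(θ) ⪯ L·I for all θ ∈ B(θ*, M). Define κ = L/ρ, κ_w = (max_{j∈S} √w_j)·(Σ_{j∈S} √w_j)/(Σ_{j∈S} w_j) and ε = (max_{j∈S} √w_j)·(Σ_{j∈S^c} √w_j)/(Σ_{j∈S} w_j). Suppose κε < 1 and 3κκ_w·max_{j∈S}{√w_j·‖∇f_j(θ*)‖₂}/(1 − κε) < λ < L·M·min_{j∈S} √w_j. Then the function θ ↦ Σ_{j∈S} w_j f_j(θ) has a unique global minimizer θ̃ with ‖θ̃ − θ*‖₂ ≤ ‖Σ_{j∈S} w_j·∇f_j(θ*)‖₂/(ρ·Σ_{j∈S} w_j), and every minimizer (θ̂_1,…,θ̂_m, β̂) of (θ_1,…,θ_m,β) ↦ Σ_{j=1}^m w_j [ f_j(θ_j) + λ_j‖β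 − θ_j‖₂ ] satisfies θ̂_j = β̂ for all j ∈ S and ‖β̂ − θ̃‖₂ ≤ λ·(Σ_{j∈S^c} √w_j)/(ρ·Σ_{j∈S} w_j) ≤ ελ/(ρ·max_{j∈S} √w_j). -/

import Mathlib

open Metric Finset

/-- The quadratic form of the Hessian of `f` at `θ`, evaluated at `v`. -/
noncomputable def hessQ {d : ℕ} (f : EuclideanSpace ℝ (Fin d) → ℝ)
    (θ v : EuclideanSpace ℝ (Fin d)) : ℝ :=
  iteratedFDeriv ℝ 2 f θ ![v, v]

lemma aux_dir {E : Type*} [NormedAddCommGroup E] [NormedSpace ℝ E] {f : E → ℝ} {f' : E →L[ℝ] ℝ}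
    {x v : E} {c : ℝ} (hf : HasFDerivAt f f' x)
    (h : ∀ t : ℝ, 0 < t → t ≤ 1 → t * c ≤ f (x + t • v) - f x) : c ≤ f' v := by
  have hd : HasDerivAt (fun t : ℝ => f (x + t • v)) (f' v) 0 := by
    have h1 : HasDerivAt (fun t : ℝ => x + t • v) v 0 := by
      simpa using ((hasDerivAt_id (0:ℝ)).smul_const v).const_add x
    have h2 : HasFDerivAt f f' (x + (0:ℝ) • v) := by simpa using hf
    exact h2.comp_hasDerivAt (0:ℝ) h1
  have h3 := hd.tendsto_slope_zero_right
  refine ge_of_tendsto h3 ?_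
  have : Set.Ioc (0:ℝ) 1 ∈ nhdsWithin (0:ℝ) (Set.Ioi 0) := Ioc_mem_nhdsGT (by norm_num)
  filter_upwards [this] with t ht
  have := h t ht.1 ht.2
  simp only [zero_add, zero_smul, add_zero, smul_eq_mul]
  rw [← div_eq_inv_mul, le_div_iff₀ ht.1]
  linarith

lemma aux_grad {E : Type*} [NormedAddCommGroup E] [NormedSpace ℝ E] {f : E → ℝ}
    (hc : ConvexOn ℝ Set.univ f) (hf : Differentiable ℝ f) (x y : E) :
    fderiv ℝ f x (y - x) ≤ f y - f x := by
  have h := aux_dir (f := fun z => - f z) (c := -(f y - f x)) (v := y - x)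
    ((hf x).hasFDerivAt.neg) (by
      intro t h0 h1
      have := hc.2 (Set.mem_univ x) (Set.mem_univ y) (sub_nonneg.2 h1) h0.le (by ring)
      have e : x + t • (y - x) = (1 - t) • x + t • y := by module
      rw [e]
      simp only [smul_eq_mul] at this
      linarith)
  simp only [ContinuousLinearMap.neg_apply] at h
  linarith

lemma aux_mv {d : ℕ} {f : EuclideanSpace ℝ (Fin d) → ℝ} (hf : ContDiff ℝ 2 f)
    (x y v : EuclideanSpace ℝ (Fin d)) :
    ∃ t ∈ Set.Ioo (0:ℝ) 1, fderiv ℝ (fderiv ℝ f) (x + t • (y - x)) (y - x) v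
      = fderiv ℝ f y v - fderiv ℝ f x v := by
  have hd : Differentiable ℝ (fderiv ℝ f) :=
    (hf.fderiv_right (m := 1) (by norm_num)).differentiable (by norm_num)
  have hD : ∀ t : ℝ, HasDerivAt (fun t : ℝ => fderiv ℝ f (x + t • (y - x)) v)
      (fderiv ℝ (fderiv ℝ f) (x + t • (y - x)) (y - x) v) t := by
    intro t
    have h1 : HasDerivAt (fun t : ℝ => x + t • (y - x)) (y - x) t := by
      simpa using ((hasDerivAt_id t).smul_const (y - x)).const_add x
    have h2 := (hd (x + t • (y - x))).hasFDerivAt.comp_hasDerivAt t h1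
    simpa using h2.clm_apply (hasDerivAt_const t v)
  obtain ⟨t, ht, h⟩ := exists_hasDerivAt_eq_slope _ _ (zero_lt_one (α := ℝ))
    (fun t _ => (hD t).continuousAt.continuousWithinAt) (fun t _ => hD t)
  refine ⟨t, ht, ?_⟩
  rw [h]
  simp

lemma aux_mono {d : ℕ} {f : EuclideanSpace ℝ (Fin d) → ℝ} (hf : ContDiff ℝ 2 f)
    {θs : EuclideanSpace ℝ (Fin d)} {M ρ L : ℝ}
    (hh : ∀ θ ∈ closedBall θs M, ∀ v, ρ * ‖v‖ ^ 2 ≤ hessQ f θ v ∧ hessQ f θ v ≤ L * ‖v‖ ^ 2)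
    {x y : EuclideanSpace ℝ (Fin d)} (hx : x ∈ closedBall θs M) (hy : y ∈ closedBall θs M) :
    ρ * ‖y - x‖ ^ 2 ≤ fderiv ℝ f y (y - x) - fderiv ℝ f x (y - x) := by
  obtain ⟨t, ht, h⟩ := aux_mv hf x y (y - x)
  rw [← h]
  have hm : x + t • (y - x) ∈ closedBall θs M :=
    (convex_closedBall θs M).add_smul_sub_mem hx hy ⟨ht.1.le, ht.2.le⟩
  have := (hh _ hm (y - x)).1
  rw [hessQ, iteratedFDeriv_two_apply] at this
  simpa using this

lemma aux_lip {d : ℕ} {f : EuclideanSpace ℝ (Fin d) → ℝ} (hf : ContDiff ℝ 2 f)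
    {θs : EuclideanSpace ℝ (Fin d)} {M ρ L : ℝ} (hρ : 0 < ρ) (hρL : ρ ≤ L)
    (hh : ∀ θ ∈ closedBall θs M, ∀ v, ρ * ‖v‖ ^ 2 ≤ hessQ f θ v ∧ hessQ f θ v ≤ L * ‖v‖ ^ 2)
    {x y : EuclideanSpace ℝ (Fin d)} (hx : x ∈ closedBall θs M) (hy : y ∈ closedBall θs M) :
    ‖fderiv ℝ f y - fderiv ℝ f x‖ ≤ L * ‖y - x‖ := by
  have key : ∀ p ∈ closedBall θs M, ∀ u v, fderiv ℝ (fderiv ℝ f) p u v ≤ L * ‖u‖ * ‖v‖ := by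
    intro p hp
    have hs : IsSymmSndFDerivAt ℝ f p := hf.contDiffAt.isSymmSndFDerivAt (by simp)
    have q : ∀ v, 0 ≤ fderiv ℝ (fderiv ℝ f) p v v ∧
        fderiv ℝ (fderiv ℝ f) p v v ≤ L * ‖v‖ ^ 2 := by
      intro v
      have := hh p hp v
      rw [hessQ, iteratedFDeriv_two_apply] at this
      simp only [Matrix.cons_val_zero, Matrix.cons_val_one] at this
      exact ⟨le_trans (by positivity) this.1, this.2⟩
    intro u v
    rcases eq_or_ne u 0 with rfl | hu
    · simp
    rcases eq_or_ne v 0 with rfl | hv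
    · simp
    have hu' : 0 < ‖u‖ := norm_pos_iff.2 hu
    have hv' : 0 < ‖v‖ := norm_pos_iff.2 hv
    have h1 := (q (‖v‖ • u + ‖u‖ • v)).2
    have h2 := (q (‖v‖ • u - ‖u‖ • v)).1
    have h3 : ‖‖v‖ • u + ‖u‖ • v‖ ≤ 2 * (‖u‖ * ‖v‖) := by
      refine (norm_add_le _ _).trans ?_
      rw [norm_smul, norm_smul, norm_norm, norm_norm]
      linarith [mul_comm ‖u‖ ‖v‖]
    have h4 : ‖‖v‖ • u + ‖u‖ • v‖ ^ 2 ≤ (2 * (‖u‖ * ‖v‖)) ^ 2 := by gcongr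
    have h5 := mul_le_mul_of_nonneg_left h4 (hρ.le.trans hρL)
    simp only [map_add, map_sub, map_smul, ContinuousLinearMap.add_apply,
      ContinuousLinearMap.sub_apply, ContinuousLinearMap.smul_apply, smul_eq_mul] at h1 h2
    rw [hs v u] at h1 h2
    have hpos : 0 < ‖u‖ * ‖v‖ := by positivity
    refine le_of_mul_le_mul_left ?_ hpos
    nlinarith
  have k2 : ∀ v, fderiv ℝ f y v - fderiv ℝ f x v ≤ L * ‖y - x‖ * ‖v‖ := by
    intro v
    obtain ⟨t, ht, h⟩ := aux_mv hf x y v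
    rw [← h]
    exact key _ ((convex_closedBall θs M).add_smul_sub_mem hx hy ⟨ht.1.le, ht.2.le⟩) _ _
  refine ContinuousLinearMap.opNorm_le_bound _
    (mul_nonneg (hρ.le.trans hρL) (norm_nonneg _)) fun v => ?_
  rw [Real.norm_eq_abs, abs_le]
  have a := k2 v
  have b := k2 (-v)
  simp only [map_neg, norm_neg] at b
  simp only [ContinuousLinearMap.sub_apply]
  constructor <;> linarith

lemma aux_oracle {d : ℕ} {F : EuclideanSpace ℝ (Fin d) → ℝ} (hc : ConvexOn ℝ Set.univ F)
    (hF : Differentiable ℝ F) {θs : EuclideanSpace ℝ (Fin d)} {M c : ℝ} (hM : 0 < M) (hcp : 0 < c)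
    (hmono : ∀ x ∈ closedBall θs M, ∀ y ∈ closedBall θs M,
      c * ‖y - x‖ ^ 2 ≤ fderiv ℝ F y (y - x) - fderiv ℝ F x (y - x))
    (hN : ‖fderiv ℝ F θs‖ / c < M) :
    ∃ θt, (∀ θ, F θt ≤ F θ) ∧ (∀ θ', (∀ θ, F θ' ≤ F θ) → θ' = θt) ∧
      ‖θt - θs‖ ≤ ‖fderiv ℝ F θs‖ / c := by
  obtain ⟨θt, hθt, hmin⟩ := (isCompact_closedBall θs M).exists_isMinOn
    ⟨θs, mem_closedBall_self hM.le⟩ hF.continuous.continuousOn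
  have hs : θs ∈ closedBall θs M := mem_closedBall_self hM.le
  have hvi : 0 ≤ fderiv ℝ F θt (θs - θt) := by
    refine aux_dir (hF θt).hasFDerivAt fun t h0 h1 => ?_
    have := hmin ((convex_closedBall θs M).add_smul_sub_mem hθt hs ⟨h0.le, h1⟩)
    simp only [Set.mem_setOf_eq] at this
    linarith
  have hb : ‖θt - θs‖ ≤ ‖fderiv ℝ F θs‖ / c := by
    have h1 := hmono θs hs θt hθt
    have h2 : fderiv ℝ F θt (θt - θs) ≤ 0 := by
      rw [← neg_sub, map_neg]; linarith
    have h3 : -(fderiv ℝ F θs (θt - θs)) ≤ ‖fderiv ℝ F θs‖ * ‖θt - θs‖ :=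
      (neg_le_abs _).trans ((fderiv ℝ F θs).le_opNorm _)
    rw [le_div_iff₀ hcp]
    rcases (norm_nonneg (θt - θs)).eq_or_lt with h | h
    · rw [← h]; simp
    · refine le_of_mul_le_mul_right ?_ h
      nlinarith
  have hball : θt ∈ ball θs M := by
    rw [mem_ball, dist_eq_norm]; linarith
  have hloc : IsLocalMin F θt := by
    filter_upwards [isOpen_ball.mem_nhds hball] with z hz using hmin (ball_subset_closedBall hz)
  have hglob : ∀ θ, F θt ≤ F θ := fun θ => IsMinOn.of_isLocalMin_of_convex_univ hloc hc (θ)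
  have hz : ∀ p, (∀ θ, F p ≤ F θ) → fderiv ℝ F p = 0 := by
    intro p hp
    exact IsLocalMin.fderiv_eq_zero (Filter.Eventually.of_forall hp)
  refine ⟨θt, hglob, ?_, hb⟩
  intro θ' h'
  by_contra hne
  have hev : ∀ᶠ t in nhdsWithin (0:ℝ) (Set.Ioi 0), θt + t • (θ' - θt) ∈ ball θs M := by
    have : Filter.Tendsto (fun t : ℝ => θt + t • (θ' - θt)) (nhds 0) (nhds θt) := by
      have : Continuous (fun t : ℝ => θt + t • (θ' - θt)) := by fun_prop
      simpa using this.tendsto 0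
    exact (this.mono_left nhdsWithin_le_nhds).eventually (isOpen_ball.mem_nhds hball)
  have hI : ∀ᶠ t in nhdsWithin (0:ℝ) (Set.Ioi 0), t ∈ Set.Ioc (0:ℝ) 1 :=
    Ioc_mem_nhdsGT (by norm_num)
  obtain ⟨t, ht, ht'⟩ := (hev.and hI).exists
  set p := θt + t • (θ' - θt) with hp
  have hpmin : ∀ θ, F p ≤ F θ := by
    intro θ
    have := hc.2 (Set.mem_univ θt) (Set.mem_univ θ') (sub_nonneg.2 ht'.2) ht'.1.le (by ring)
    have e : p = (1 - t) • θt + t • θ' := by rw [hp]; module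
    rw [← e] at this
    simp only [smul_eq_mul] at this
    have a : F θ' = F θt := le_antisymm (h' _) (hglob _)
    rw [a] at this
    have := hglob θ
    linarith
  have h1 := hmono θt hθt p (ball_subset_closedBall ht)
  rw [hz p hpmin, hz θt hglob] at h1
  have h2 : 0 < ‖p - θt‖ := by
    rw [norm_pos_iff, hp, add_sub_cancel_left]
    exact smul_ne_zero ht'.1.ne' (sub_ne_zero.2 hne)
  have : 0 < c * ‖p - θt‖ ^ 2 := by positivity
  simp at h1
  nlinarith

/-- First-order optimality conditions at a minimizer. -/
lemma aux_opt {d m : ℕ} {f : Fin m → EuclideanSpace ℝ (Fin d) → ℝ}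
    (hdiff : ∀ j, Differentiable ℝ (f j))
    {w : Fin m → ℝ} (hw : ∀ j, 0 < w j) {l : Fin m → ℝ} (hl : ∀ j, 0 < l j)
    {θhat : Fin m → EuclideanSpace ℝ (Fin d)} {βhat : EuclideanSpace ℝ (Fin d)}
    (h : ∀ (θ : Fin m → EuclideanSpace ℝ (Fin d)) (β : EuclideanSpace ℝ (Fin d)),
          ∑ j, w j * (f j (θhat j) + l j * ‖βhat - θhat j‖) ≤
          ∑ j, w j * (f j (θ j) + l j * ‖β - θ j‖)) :
    (∀ j, ‖fderiv ℝ (f j) (θhat j)‖ ≤ l j) ∧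
    (∀ j, l j * ‖βhat - θhat j‖ ≤ fderiv ℝ (f j) (θhat j) (βhat - θhat j)) ∧
    (∀ j, l j * ‖βhat - θhat j‖ ≤ f j βhat - f j (θhat j)) ∧
    (∑ j, w j • fderiv ℝ (f j) (θhat j) = 0) := by
  classical
  have hj : ∀ j x, f j (θhat j) + l j * ‖βhat - θhat j‖ ≤ f j x + l j * ‖βhat - x‖ := by
    intro j x
    have := h (Function.update θhat j x) βhat
    rw [← Finset.add_sum_erase _ _ (mem_univ j), ← Finset.add_sum_erase _ _ (mem_univ j)] at this
    have e : ∑ i ∈ univ.erase j, w i * (f i (Function.update θhat j x i)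
          + l i * ‖βhat - Function.update θhat j x i‖)
        = ∑ i ∈ univ.erase j, w i * (f i (θhat i) + l i * ‖βhat - θhat i‖) := by
      refine Finset.sum_congr rfl fun i hi => ?_
      rw [Function.update_of_ne (Finset.ne_of_mem_erase hi)]
    rw [e] at this
    simp only [Function.update_self] at this
    exact le_of_mul_le_mul_left (by linarith) (hw j)
  refine ⟨fun j => ?_, fun j => ?_, fun j => ?_, ?_⟩
  · have k : ∀ v, -(l j * ‖v‖) ≤ fderiv ℝ (f j) (θhat j) v := by
      intro v
      refine aux_dir (hdiff j _).hasFDerivAt fun t h0 h1 => ?_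
      have a := hj j (θhat j + t • v)
      have b : ‖βhat - (θhat j + t • v)‖ ≤ ‖βhat - θhat j‖ + t * ‖v‖ := by
        have := norm_sub_le (βhat - θhat j) (t • v)
        rw [norm_smul, Real.norm_of_nonneg h0.le] at this
        rwa [← sub_sub]
      have := mul_le_mul_of_nonneg_left b (hl j).le
      linarith
    refine ContinuousLinearMap.opNorm_le_bound _ (hl j).le fun v => ?_
    rw [Real.norm_eq_abs, abs_le]
    have a := k v
    have b := k (-v)
    simp only [map_neg, norm_neg] at b
    constructor <;> linarith
  · refine aux_dir (hdiff j _).hasFDerivAt fun t h0 h1 => ?_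
    have a := hj j (θhat j + t • (βhat - θhat j))
    have b : βhat - (θhat j + t • (βhat - θhat j)) = (1 - t) • (βhat - θhat j) := by module
    rw [b, norm_smul, Real.norm_of_nonneg (sub_nonneg.2 h1)] at a
    linarith
  · have := hj j βhat
    simp at this
    linarith
  · have k : ∀ v, 0 ≤ (∑ j, w j • fderiv ℝ (f j) (θhat j)) v := by
      intro v
      have hF : HasFDerivAt (fun x => ∑ j, w j * f j (θhat j + x))
          (∑ j, w j • fderiv ℝ (f j) (θhat j)) 0 := by
        refine HasFDerivAt.fun_sum fun j _ => ?_
        refine HasFDerivAt.const_mul ?_ (w j)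
        have : HasFDerivAt (f j) (fderiv ℝ (f j) (θhat j)) (θhat j + 0) := by
          rw [add_zero]; exact (hdiff j _).hasFDerivAt
        have h2 := this.comp (0 : EuclideanSpace ℝ (Fin d)) ((hasFDerivAt_id _).const_add (θhat j))
        simpa [Function.comp_def] using h2
      refine aux_dir hF fun t h0 h1 => ?_
      have := h (fun j => θhat j + t • v) (βhat + t • v)
      simp only [add_sub_add_right_eq_sub, mul_add, Finset.sum_add_distrib] at this
      simp only [zero_add, add_zero, mul_zero]
      linarith
    ext v
    have a := k v
    have b := k (-v)
    rw [map_neg] at b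
    rw [ContinuousLinearMap.zero_apply]
    linarith

/-- Localization of the coordinator. -/
lemma aux_loc {d m : ℕ} {f : Fin m → EuclideanSpace ℝ (Fin d) → ℝ}
    (hconv : ∀ j, ConvexOn ℝ Set.univ (f j)) (hdiff : ∀ j, Differentiable ℝ (f j))
    {w : Fin m → ℝ} (hw : ∀ j, 0 < w j) {l : Fin m → ℝ} (S : Finset (Fin m))
    {θhat : Fin m → EuclideanSpace ℝ (Fin d)} {βhat θt : EuclideanSpace ℝ (Fin d)}
    (o1 : ∀ j, ‖fderiv ℝ (f j) (θhat j)‖ ≤ l j)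
    (o2 : ∀ j, l j * ‖βhat - θhat j‖ ≤ fderiv ℝ (f j) (θhat j) (βhat - θhat j))
    (o4 : ∑ j, w j • fderiv ℝ (f j) (θhat j) = 0)
    {c r1 r2 : ℝ} (hc : 0 < c) (hr1 : r1 = (∑ j ∈ Sᶜ, w j * l j) / c) (hr12 : r1 < r2)
    (hmono : ∀ y, ‖y - θt‖ ≤ r2 →
      c * ‖y - θt‖ ^ 2 ≤ ∑ j ∈ S, w j * fderiv ℝ (f j) y (y - θt))
    (hg : ∀ y, ‖y - θt‖ ≤ r2 → ∀ j ∈ S, ‖fderiv ℝ (f j) y‖ ≤ l j) :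
    ‖βhat - θt‖ ≤ r1 := by
  by_contra! hlt
  have hl : ∀ j, 0 ≤ l j := fun j => (norm_nonneg _).trans (o1 j)
  have hr10 : 0 ≤ r1 := by
    rw [hr1]
    exact div_nonneg (Finset.sum_nonneg fun j _ => mul_nonneg (hw j).le (hl j)) hc.le
  obtain ⟨r, hr, hr'⟩ := exists_between (lt_min hr12 hlt)
  have hr2 : r < r2 := hr'.trans_le (min_le_left _ _)
  have hrD : r < ‖βhat - θt‖ := hr'.trans_le (min_le_right _ _)
  have hD : 0 < ‖βhat - θt‖ := by linarith
  have hr0 : 0 < r := by linarith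
  set t := r / ‖βhat - θt‖ with ht
  have ht0 : 0 < t := by positivity
  have ht1 : t < 1 := by rw [ht, div_lt_one hD]; exact hrD
  set y := θt + t • (βhat - θt) with hy
  have e1 : y - θt = t • (βhat - θt) := by rw [hy]; module
  have e2 : βhat - y = (1 - t) • (βhat - θt) := by rw [hy]; module
  have hyn : ‖y - θt‖ = r := by
    rw [e1, norm_smul, Real.norm_of_nonneg ht0.le, ht]; field_simp
  have hy2 : ‖y - θt‖ ≤ r2 := by rw [hyn]; exact hr2.le
  have hj : ∀ j ∈ S, fderiv ℝ (f j) y (y - θt) ≤ fderiv ℝ (f j) (θhat j) (y - θt) := by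
    intro j hjS
    have a1 := aux_grad (hconv j) (hdiff j) (θhat j) y
    have a2 := aux_grad (hconv j) (hdiff j) y (θhat j)
    have a3 : fderiv ℝ (f j) y (βhat - θhat j) ≤ l j * ‖βhat - θhat j‖ :=
      (le_abs_self _).trans (((fderiv ℝ (f j) y).le_opNorm _).trans
        (mul_le_mul_of_nonneg_right (hg y hy2 j hjS) (norm_nonneg _)))
    have a4 := o2 j
    have a5 : fderiv ℝ (f j) y (βhat - y) ≤ fderiv ℝ (f j) (θhat j) (βhat - y) := by
      simp only [map_sub] at a1 a2 a3 a4 ⊢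
      linarith
    rw [e2] at a5
    rw [e1]
    simp only [map_smul, smul_eq_mul] at a5 ⊢
    have := le_of_mul_le_mul_left a5 (sub_pos.2 ht1)
    exact mul_le_mul_of_nonneg_left this ht0.le
  have b1 := hmono y hy2
  have b2 : ∑ j ∈ S, w j * fderiv ℝ (f j) y (y - θt)
      ≤ ∑ j ∈ S, w j * fderiv ℝ (f j) (θhat j) (y - θt) :=
    Finset.sum_le_sum fun j hjS => mul_le_mul_of_nonneg_left (hj j hjS) (hw j).le
  have b3 : ∑ j, w j * fderiv ℝ (f j) (θhat j) (y - θt) = 0 := by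
    have := congrArg (fun g : EuclideanSpace ℝ (Fin d) →L[ℝ] ℝ => g (y - θt)) o4
    simpa [ContinuousLinearMap.sum_apply] using this
  rw [← Finset.sum_add_sum_compl S] at b3
  have b4 : -((∑ j ∈ Sᶜ, w j * l j) * r) ≤ ∑ j ∈ Sᶜ, w j * fderiv ℝ (f j) (θhat j) (y - θt) := by
    rw [Finset.sum_mul, ← Finset.sum_neg_distrib]
    refine Finset.sum_le_sum fun j _ => ?_
    have : -(fderiv ℝ (f j) (θhat j) (y - θt)) ≤ l j * r := by
      rw [← hyn]
      exact (neg_le_abs _).trans (((fderiv ℝ (f j) (θhat j)).le_opNorm _).trans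
        (mul_le_mul_of_nonneg_right (o1 j) (norm_nonneg _)))
    have := mul_le_mul_of_nonneg_left this (hw j).le
    linarith
  have b5 : ∑ j ∈ Sᶜ, w j * l j = c * r1 := by rw [hr1]; field_simp
  rw [b5] at b4
  rw [hyn] at b1
  have : c * r ^ 2 ≤ c * r1 * r := by linarith
  have : c * r1 * r < c * r ^ 2 := by
    have : c * r * r1 < c * r * r := mul_lt_mul_of_pos_left hr (by positivity)
    linarith
  linarith

/-- Robustness of vanilla ARMUL: the estimates of the tasks in `S` all collapse to the
coordinator `β̂`, which is close to the oracle pooled minimizer over `S`. -/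
theorem stmt_10 (d m : ℕ) (hd : 1 ≤ d) (hm : 1 ≤ m)
    (f : Fin m → EuclideanSpace ℝ (Fin d) → ℝ)
    (hconv : ∀ j, ConvexOn ℝ Set.univ (f j)) (hdiff : ∀ j, Differentiable ℝ (f j))
    (w : Fin m → ℝ) (hw : ∀ j, 0 < w j) (lam : ℝ) (hlam0 : 0 < lam)
    (S : Finset (Fin m)) (hS : S.Nonempty)
    (θstar : EuclideanSpace ℝ (Fin d)) (M ρ L κ κw ε wmax : ℝ)
    (hM : 0 < M) (hρ : 0 < ρ) (hρL : ρ ≤ L)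
    (hC2 : ∀ j ∈ S, ContDiff ℝ 2 (f j))
    (hhess : ∀ j ∈ S, ∀ θ ∈ closedBall θstar M, ∀ v,
      ρ * ‖v‖ ^ 2 ≤ hessQ (f j) θ v ∧ hessQ (f j) θ v ≤ L * ‖v‖ ^ 2)
    (hκ : κ = L / ρ)
    (hwmax : IsGreatest ((fun j => Real.sqrt (w j)) '' (S : Set (Fin m))) wmax)
    (hκw : κw = wmax * (∑ j ∈ S, Real.sqrt (w j)) / (∑ j ∈ S, w j))
    (hε : ε = wmax * (∑ j ∈ Sᶜ, Real.sqrt (w j)) / (∑ j ∈ S, w j))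
    (hκε : κ * ε < 1)
    (hlam1 : ∀ j ∈ S,
      3 * κ * κw * (Real.sqrt (w j) * ‖gradient (f j) θstar‖) / (1 - κ * ε) < lam)
    (hlam2 : ∀ j ∈ S, lam < L * M * Real.sqrt (w j)) :
    ∃ θt : EuclideanSpace ℝ (Fin d),
      (∀ θ, ∑ j ∈ S, w j * f j θt ≤ ∑ j ∈ S, w j * f j θ) ∧
      (∀ θ', (∀ θ, ∑ j ∈ S, w j * f j θ' ≤ ∑ j ∈ S, w j * f j θ) → θ' = θt) ∧
      ‖θt - θstar‖ ≤ ‖∑ j ∈ S, w j • gradient (f j) θstar‖ / (ρ * ∑ j ∈ S, w j) ∧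
      ∀ (θhat : Fin m → EuclideanSpace ℝ (Fin d)) (βhat : EuclideanSpace ℝ (Fin d)),
        (∀ (θ : Fin m → EuclideanSpace ℝ (Fin d)) (β : EuclideanSpace ℝ (Fin d)),
          ∑ j, w j * (f j (θhat j) + lam / Real.sqrt (w j) * ‖βhat - θhat j‖) ≤
          ∑ j, w j * (f j (θ j) + lam / Real.sqrt (w j) * ‖β - θ j‖)) →
        (∀ j ∈ S, θhat j = βhat) ∧
        ‖βhat - θt‖ ≤ lam * (∑ j ∈ Sᶜ, Real.sqrt (w j)) / (ρ * ∑ j ∈ S, w j) ∧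
        lam * (∑ j ∈ Sᶜ, Real.sqrt (w j)) / (ρ * ∑ j ∈ S, w j) ≤
          ε * lam / (ρ * wmax) := by
  have hs : ∀ j, 0 < Real.sqrt (w j) := fun j => Real.sqrt_pos.2 (hw j)
  have hss : ∀ j, w j = Real.sqrt (w j) * Real.sqrt (w j) := fun j =>
    (Real.mul_self_sqrt (hw j).le).symm
  have hL : 0 < L := hρ.trans_le hρL
  have hle : ∀ j ∈ S, Real.sqrt (w j) ≤ wmax := fun j hj => hwmax.2 ⟨j, hj, rfl⟩
  have hwm : 0 < wmax := by
    obtain ⟨j, hj⟩ := hS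
    exact (hs j).trans_le (hle j hj)
  set W := ∑ j ∈ S, w j with hWdef
  have hW : 0 < W := Finset.sum_pos (fun j _ => hw j) hS
  set T := ∑ j ∈ S, Real.sqrt (w j) with hTdef
  have hT : 0 < T := Finset.sum_pos (fun j _ => hs j) hS
  set U := ∑ j ∈ Sᶜ, Real.sqrt (w j) with hUdef
  have hU : 0 ≤ U := Finset.sum_nonneg fun j _ => (hs j).le
  have hκ1 : 1 ≤ κ := by rw [hκ, one_le_div hρ]; exact hρL
  have hκw1 : 1 ≤ κw := by
    rw [hκw, one_le_div hW, hWdef, hTdef, Finset.mul_sum]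
    refine Finset.sum_le_sum fun j hj => ?_
    exact (hss j).le.trans (mul_le_mul_of_nonneg_right (hle j hj) (hs j).le)
  have hε0 : 0 ≤ ε := by rw [hε]; positivity
  set K := κ * ε with hK
  have hK0 : 0 ≤ K := mul_nonneg (by linarith) hε0
  obtain ⟨a, ha⟩ : ∃ a, a = (1 - K) / 3 := ⟨_, rfl⟩
  have ha0 : 0 < a := by rw [ha]; linarith
  have hgn : ∀ j x, ‖gradient (f j) x‖ = ‖fderiv ℝ (f j) x‖ := by
    intro j x
    rw [gradient, LinearIsometryEquiv.norm_map]
  have hg1 : ∀ j ∈ S, κ * κw * (Real.sqrt (w j) * ‖fderiv ℝ (f j) θstar‖) < lam * a := by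
    intro j hj
    have := hlam1 j hj
    rw [hgn, div_lt_iff₀ (by linarith)] at this
    rw [ha]
    linarith
  have hg2 : ∀ j ∈ S, Real.sqrt (w j) * ‖fderiv ℝ (f j) θstar‖ < lam * a := by
    intro j hj
    refine lt_of_le_of_lt ?_ (hg1 j hj)
    refine le_mul_of_one_le_left (by positivity) ?_
    exact one_le_mul_of_one_le_of_one_le hκ1 hκw1
  have hFd : ∀ x, HasFDerivAt (fun θ => ∑ j ∈ S, w j * f j θ)
      (∑ j ∈ S, w j • fderiv ℝ (f j) x) x := fun x =>
    HasFDerivAt.fun_sum fun j _ => ((hdiff j x).hasFDerivAt).const_mul (w j)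
  have hFdiff : Differentiable ℝ (fun θ => ∑ j ∈ S, w j * f j θ) :=
    fun x => (hFd x).differentiableAt
  have hFc : ConvexOn ℝ Set.univ (fun θ => ∑ j ∈ S, w j * f j θ) := by
    refine ⟨convex_univ, fun x _ y _ p q hp hq hpq => ?_⟩
    simp only [smul_eq_mul]
    rw [Finset.mul_sum, Finset.mul_sum, ← Finset.sum_add_distrib]
    refine Finset.sum_le_sum fun j _ => ?_
    have := mul_le_mul_of_nonneg_left
      ((hconv j).2 (Set.mem_univ x) (Set.mem_univ y) hp hq hpq) (hw j).le
    simp only [smul_eq_mul] at this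
    linarith
  have hFapp : ∀ x v, fderiv ℝ (fun θ => ∑ j ∈ S, w j * f j θ) x v
      = ∑ j ∈ S, w j * fderiv ℝ (f j) x v := by
    intro x v
    rw [(hFd x).fderiv]
    simp [ContinuousLinearMap.sum_apply]
  have hFmono : ∀ x ∈ closedBall θstar M, ∀ y ∈ closedBall θstar M,
      ρ * W * ‖y - x‖ ^ 2 ≤ fderiv ℝ (fun θ => ∑ j ∈ S, w j * f j θ) y (y - x)
        - fderiv ℝ (fun θ => ∑ j ∈ S, w j * f j θ) x (y - x) := by
    intro x hx y hy
    rw [hFapp, hFapp, ← Finset.sum_sub_distrib, hWdef, Finset.mul_sum, Finset.sum_mul]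
    refine Finset.sum_le_sum fun j hj => ?_
    have := mul_le_mul_of_nonneg_left (aux_mono (hC2 j hj) (hhess j hj) hx hy) (hw j).le
    linarith
  have hNeq : ‖∑ j ∈ S, w j • gradient (f j) θstar‖
      = ‖fderiv ℝ (fun θ => ∑ j ∈ S, w j * f j θ) θstar‖ := by
    rw [(hFd θstar).fderiv, ← LinearIsometryEquiv.norm_map
      (InnerProductSpace.toDual ℝ (EuclideanSpace ℝ (Fin d))).symm]
    congr 1
    simp [gradient, map_sum, map_smulₛₗ]
  set N := ‖fderiv ℝ (fun θ => ∑ j ∈ S, w j * f j θ) θstar‖ with hN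
  have hNb : κ * κw * N ≤ lam * a * T := by
    have h1 : N ≤ ∑ j ∈ S, Real.sqrt (w j) * (Real.sqrt (w j) * ‖fderiv ℝ (f j) θstar‖) := by
      rw [hN, (hFd θstar).fderiv]
      refine (norm_sum_le _ _).trans (Finset.sum_le_sum fun j _ => ?_)
      rw [norm_smul, Real.norm_of_nonneg (hw j).le, ← mul_assoc, ← hss j]
    refine (mul_le_mul_of_nonneg_left h1 (by positivity)).trans ?_
    rw [Finset.mul_sum, hTdef, Finset.mul_sum]
    refine Finset.sum_le_sum fun j hj => ?_
    have := mul_le_mul_of_nonneg_left (hg1 j hj).le (hs j).le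
    linarith
  have hr0 : L * wmax * (N / (ρ * W)) ≤ lam * a := by
    refine le_of_mul_le_mul_right ?_ hT
    refine le_trans (le_of_eq ?_) hNb
    rw [hκ, hκw]
    field_simp
  have hr1 : L * wmax * (lam * U / (ρ * W)) = lam * K := by
    rw [hK, hκ, hε]
    field_simp
  have hsum : 3 * a + K = 1 := by rw [ha]; ring
  have hwM : lam < L * wmax * M := by
    obtain ⟨j, hj⟩ := hS
    have h1 := hlam2 j hj
    have := mul_le_mul_of_nonneg_left (hle j hj) (mul_pos hL hM).le
    linarith
  have hLw : 0 < L * wmax := mul_pos hL hwm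
  have hrM : N / (ρ * W) < M := by
    refine lt_of_mul_lt_mul_left ?_ hLw.le
    nlinarith
  obtain ⟨θt, hmin, huniq, hdist⟩ := aux_oracle hFc hFdiff hM (mul_pos hρ hW) hFmono hrM
  rw [hNeq]
  refine ⟨θt, hmin, huniq, hdist, ?_⟩
  intro θhat βhat hopt
  obtain ⟨o1, o2, o3, o4⟩ := aux_opt hdiff hw (l := fun j => lam / Real.sqrt (w j))
    (fun j => div_pos hlam0 (hs j)) hopt
  obtain ⟨r2, hr2⟩ : ∃ r2, r2 = lam * (K + a) / (L * wmax) := ⟨_, rfl⟩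
  have hr2' : L * wmax * r2 = lam * (K + a) := by rw [hr2]; field_simp
  have hr12 : lam * U / (ρ * W) < r2 := by
    refine lt_of_mul_lt_mul_left ?_ hLw.le
    rw [hr1, hr2']
    nlinarith
  have hnear : ∀ y, ‖y - θt‖ ≤ r2 → L * wmax * ‖y - θstar‖ ≤ lam * (2 * a + K) := by
    intro y hy
    have h1 : ‖y - θstar‖ ≤ r2 + N / (ρ * W) := by
      have := norm_sub_le_norm_sub_add_norm_sub y θt θstar
      linarith
    have := mul_le_mul_of_nonneg_left h1 hLw.le
    linarith
  have hself : θstar ∈ closedBall θstar M := mem_closedBall_self hM.le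
  have hball : ∀ y, ‖y - θt‖ ≤ r2 → y ∈ closedBall θstar M := by
    intro y hy
    rw [mem_closedBall, dist_eq_norm]
    refine le_of_mul_le_mul_left ?_ hLw
    have := hnear y hy
    nlinarith
  have hg : ∀ y, ‖y - θt‖ ≤ r2 → ∀ j ∈ S, ‖fderiv ℝ (f j) y‖ < lam / Real.sqrt (w j) := by
    intro y hy j hj
    rw [lt_div_iff₀ (hs j)]
    have h1 := aux_lip (hC2 j hj) hρ hρL (hhess j hj) hself (hball y hy)
    have h2 := norm_sub_norm_le (fderiv ℝ (f j) y) (fderiv ℝ (f j) θstar)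
    have h3 : ‖fderiv ℝ (f j) y‖ ≤ ‖fderiv ℝ (f j) θstar‖ + L * ‖y - θstar‖ := by linarith
    have h4 := mul_le_mul_of_nonneg_right h3 (hs j).le
    have h5 := hg2 j hj
    have h6 := mul_le_mul_of_nonneg_left (hle j hj) (mul_nonneg hL.le (norm_nonneg (y - θstar)))
    have h7 := hnear y hy
    have h8 : lam * a + lam * (2 * a + K) = lam := by
      have : lam * a + lam * (2 * a + K) = lam * (3 * a + K) := by ring
      rw [this, hsum, mul_one]
    linarith
  have hr20 : 0 ≤ r2 := by rw [hr2]; positivity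
  have hgt : fderiv ℝ (fun θ => ∑ j ∈ S, w j * f j θ) θt = 0 :=
    IsLocalMin.fderiv_eq_zero (Filter.Eventually.of_forall hmin)
  have hwl : ∀ j, w j * (lam / Real.sqrt (w j)) = lam * Real.sqrt (w j) := by
    intro j
    have := hs j
    nth_rewrite 1 [hss j]
    field_simp
  have hβ : ‖βhat - θt‖ ≤ lam * U / (ρ * W) := by
    refine aux_loc hconv hdiff hw S o1 o2 o4 (mul_pos hρ hW) ?_ hr12 ?_
      (fun y hy j hj => (hg y hy j hj).le)
    · simp only [hwl]
      rw [← Finset.mul_sum]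
    · intro y hy
      have := hFmono θt (hball θt (by simpa using hr20)) y (hball y hy)
      rw [hgt, hFapp] at this
      simpa using this
  refine ⟨fun j hj => ?_, hβ, le_of_eq ?_⟩
  · have h1 := hg βhat (hβ.trans hr12.le) j hj
    have h2 := aux_grad (hconv j) (hdiff j) βhat (θhat j)
    have h3 := o3 j
    have h4 : -(fderiv ℝ (f j) βhat (θhat j - βhat))
        ≤ ‖fderiv ℝ (f j) βhat‖ * ‖βhat - θhat j‖ := by
      rw [norm_sub_rev]
      exact (neg_le_abs _).trans ((fderiv ℝ (f j) βhat).le_opNorm _)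
    by_contra hne
    have h5 : 0 < ‖βhat - θhat j‖ := norm_pos_iff.2 (sub_ne_zero.2 (Ne.symm hne))
    have h6 := mul_lt_mul_of_pos_right h1 h5
    linarith
  · rw [hε]
    field_simp
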